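/- Let 0 < α < 1/2. Then there exists a constant C > 0, depending only on α, such that for all signs σ, σ₁, σ₂, σ₃ ∈ {−1, 1}, all fixed n₁, n₂ ∈ ℤ², and every dyadic number N₃: ∑_{m ∈ ℤ} ⟨m⟩^{−1} · ∑_{n₃ ∈ ℤ², |n₃| ∼ N₃} ⟨n₁+n₂+n₃⟩^{−1} · ⟨n₃⟩^{−2+2α} · 1_{|φ(n₁,n₂,n₃) − m| ≤ 1} ≤ C · log(2 + N₃) · ⟨n₁+n₂⟩^{−s̃_α}, where s̃_α := 1 if 0 < α < 1/4 and s̃_α := 3/2 − 2α if 1/4 ≤ α < 1/2. -/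

import Mathlib

/-- The Euclidean norm of a lattice point `x ∈ ℤ²`. -/
noncomputable def znorm (x : Fin 2 → ℤ) : ℝ :=
  Real.sqrt ((x 0 : ℝ) ^ 2 + (x 1 : ℝ) ^ 2)

/-- The Japanese bracket `⟨x⟩ = √(1 + |x|²)` for lattice points `x ∈ ℤ²`. -/
noncomputable def jb (x : Fin 2 → ℤ) : ℝ :=
  Real.sqrt (1 + (x 0 : ℝ) ^ 2 + (x 1 : ℝ) ^ 2)

/-- `|x| ∼ N`, i.e. `N/2 ≤ |x| ≤ 2N`. -/
def ann (N : ℝ) (x : Fin 2 → ℤ) : Prop :=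
  N / 2 ≤ znorm x ∧ znorm x ≤ 2 * N

/-- The cubic phase function `φ(n₁,n₂,n₃) = σ⟨n₁+n₂+n₃⟩ + σ₁⟨n₁⟩ + σ₂⟨n₂⟩ + σ₃⟨n₃⟩`. -/
noncomputable def phase (σ σ₁ σ₂ σ₃ : ℝ) (n₁ n₂ n₃ : Fin 2 → ℤ) : ℝ :=
  σ * jb (n₁ + n₂ + n₃) + σ₁ * jb n₁ + σ₂ * jb n₂ + σ₃ * jb n₃

/-- The median (middle value) of three real numbers. -/
noncomputable def med3 (a b c : ℝ) : ℝ :=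
  max (min a b) (min (max a b) c)

-- `s̃_α = 1` for `0 < α < 1/4` and `s̃_α = 3/2 − 2α` for `1/4 ≤ α < 1/2`.
open Classical in
noncomputable def sTildeAlpha (α : ℝ) : ℝ :=
  if α < 1 / 4 then 1 else 3 / 2 - 2 * α

/-- A lattice point viewed as a complex number. -/
noncomputable def toComplex (x : Fin 2 → ℤ) : ℂ := ⟨x 0, x 1⟩

theorem toComplex_add (x y : Fin 2 → ℤ) : toComplex (x + y) = toComplex x + toComplex y := by
  apply Complex.ext <;> simp [toComplex]

theorem toComplex_sub (x y : Fin 2 → ℤ) : toComplex (x - y) = toComplex x - toComplex y := by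
  apply Complex.ext <;> simp [toComplex]

theorem norm_toComplex_sq (x : Fin 2 → ℤ) :
    ‖toComplex x‖ ^ 2 = (x 0 : ℝ) ^ 2 + (x 1 : ℝ) ^ 2 := by
  rw [← Complex.normSq_eq_norm_sq, Complex.normSq_apply]
  simp [toComplex]; ring

theorem znorm_eq_norm (x : Fin 2 → ℤ) : znorm x = ‖toComplex x‖ := by
  rw [znorm, ← norm_toComplex_sq, Real.sqrt_sq (norm_nonneg _)]

theorem jb_sq (x : Fin 2 → ℤ) : jb x ^ 2 = 1 + ‖toComplex x‖ ^ 2 := by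
  rw [jb, Real.sq_sqrt (by positivity), norm_toComplex_sq]; ring

theorem jb_neg (x : Fin 2 → ℤ) : jb (-x) = jb x := by simp [jb]

theorem one_le_jb (x : Fin 2 → ℤ) : 1 ≤ jb x := by
  rw [jb, Real.one_le_sqrt]; nlinarith [sq_nonneg (x 0 : ℝ), sq_nonneg (x 1 : ℝ)]

theorem norm_le_jb (x : Fin 2 → ℤ) : ‖toComplex x‖ ≤ jb x := by
  have := jb_sq x
  exact abs_le_of_sq_le_sq' (by linarith) (by linarith [one_le_jb x]) |>.2

theorem jb_le_one_add_norm (x : Fin 2 → ℤ) : jb x ≤ 1 + ‖toComplex x‖ := by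
  have := jb_sq x
  have h := norm_nonneg (toComplex x)
  exact abs_le_of_sq_le_sq' (by nlinarith) (by linarith) |>.2

theorem abs_jb_sub_jb_le (x y : Fin 2 → ℤ) :
    |jb x - jb y| ≤ |‖toComplex x‖ - ‖toComplex y‖| := by
  have hx := jb_sq x
  have hy := jb_sq y
  have h1 := norm_le_jb x
  have h2 := norm_le_jb y
  have h3 := one_le_jb x
  have h4 := one_le_jb y
  have h5 := norm_nonneg (toComplex x)
  have h6 := norm_nonneg (toComplex y)
  have e : |jb x - jb y| * (jb x + jb y)
      = |‖toComplex x‖ - ‖toComplex y‖| * (‖toComplex x‖ + ‖toComplex y‖) := by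
    rw [← abs_of_nonneg (show 0 ≤ jb x + jb y by linarith),
      ← abs_of_nonneg (show 0 ≤ ‖toComplex x‖ + ‖toComplex y‖ by linarith),
      ← abs_mul, ← abs_mul]
    congr 1; linarith
  have h7 := abs_nonneg (‖toComplex x‖ - ‖toComplex y‖)
  nlinarith

theorem abs_jb_sub_jb_le_norm_sub (x y : Fin 2 → ℤ) :
    |jb x - jb y| ≤ ‖toComplex x - toComplex y‖ :=
  (abs_jb_sub_jb_le x y).trans (abs_norm_sub_norm_le _ _)

theorem abs_apply_le_norm (x : Fin 2 → ℤ) (i : Fin 2) : |(x i : ℝ)| ≤ ‖toComplex x‖ := by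
  fin_cases i
  · exact Complex.abs_re_le_norm (toComplex x)
  · exact Complex.abs_im_le_norm (toComplex x)

/-- Lattice points at mutual distance at most `D` number at most `(2D+1)²`. -/
theorem card_le_of_norm_sub_le (S : Finset (Fin 2 → ℤ)) (D : ℕ)
    (h : ∀ x ∈ S, ∀ y ∈ S, ‖toComplex x - toComplex y‖ ≤ D) : S.card ≤ (2 * D + 1) ^ 2 := by
  rcases S.eq_empty_or_nonempty with rfl | ⟨x₀, h₀⟩
  · simp
  have hsub : S ⊆ Fintype.piFinset (fun i => Finset.Icc (x₀ i - D) (x₀ i + D)) := by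
    intro x hx
    rw [Fintype.mem_piFinset]
    intro i
    have h1 := (abs_apply_le_norm (x - x₀) i).trans ((toComplex_sub x x₀).symm ▸ h x hx x₀ h₀)
    have h2 : |x i - x₀ i| ≤ (D : ℤ) := by
      have : |((x i - x₀ i : ℤ) : ℝ)| ≤ ((D : ℤ) : ℝ) := by simpa using h1
      exact_mod_cast this
    rw [abs_le] at h2
    rw [Finset.mem_Icc]; constructor <;> linarith [h2.1, h2.2]
  refine (Finset.card_le_card hsub).trans (le_of_eq ?_)
  have hc : ∀ i, (x₀ i + (D : ℤ) + 1 - (x₀ i - D)).toNat = 2 * D + 1 := fun i => by omega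
  simp only [Fintype.card_piFinset, Int.card_Icc, hc]
  simp

/-- Integers at mutual distance at most `D` number at most `D + 1`. -/
theorem card_int_le_of_abs_sub_le (J : Finset ℤ) (D : ℝ) (hD : 0 ≤ D)
    (h : ∀ i ∈ J, ∀ j ∈ J, |(i : ℝ) - j| ≤ D) : (J.card : ℝ) ≤ D + 1 := by
  rcases J.eq_empty_or_nonempty with rfl | hJ
  · simp; linarith
  have hsub : J ⊆ Finset.Icc (J.min' hJ) (J.max' hJ) := fun j hj =>
    Finset.mem_Icc.2 ⟨J.min'_le j hj, J.le_max' j hj⟩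
  have h1 := Finset.card_le_card hsub
  rw [Int.card_Icc] at h1
  have h2 := (le_abs_self _).trans (h _ (J.max'_mem hJ) _ (J.min'_mem hJ))
  have h3 : J.min' hJ ≤ J.max' hJ := J.min'_le _ (J.max'_mem hJ)
  have h4 : (J.card : ℤ) ≤ J.max' hJ + 1 - J.min' hJ := by omega
  have h5 : ((J.card : ℤ) : ℝ) ≤ ((J.max' hJ + 1 - J.min' hJ : ℤ) : ℝ) := by exact_mod_cast h4
  push_cast at h5
  linarith

/-- The inverse of cosine is Hölder continuous of order `1/2`. -/
theorem sub_sq_le_of_cos {a b : ℝ} (ha : 0 ≤ a) (ha' : a ≤ Real.pi) (hb : 0 ≤ b)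
    (hb' : b ≤ Real.pi) : (a - b) ^ 2 ≤ 5 * |Real.cos a - Real.cos b| := by
  wlog hab : b ≤ a generalizing a b
  · have := this hb hb' ha ha' (le_of_not_ge hab)
    rw [abs_sub_comm]; linarith [show (a - b) ^ 2 = (b - a) ^ 2 by ring]
  have hpi := Real.pi_pos
  have h0 : 0 ≤ (a - b) / 2 := by linarith
  have h1 : 2 / Real.pi * ((a - b) / 2) ≤ Real.sin ((a - b) / 2) :=
    Real.mul_le_sin h0 (by linarith)
  have h2 : Real.sin ((a - b) / 2) ≤ Real.sin ((a + b) / 2) := by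
    rcases le_total ((a + b) / 2) (Real.pi / 2) with h | h
    · exact Real.sin_le_sin_of_le_of_le_pi_div_two (by linarith) h (by linarith)
    · rw [← Real.sin_pi_sub ((a + b) / 2)]
      exact Real.sin_le_sin_of_le_of_le_pi_div_two (by linarith) (by linarith) (by linarith)
  have h3 : 0 ≤ 2 / Real.pi * ((a - b) / 2) := by positivity
  have h4 : |Real.cos a - Real.cos b| = 2 * Real.sin ((a + b) / 2) * Real.sin ((a - b) / 2) := by
    rw [Real.cos_sub_cos, abs_of_nonpos] <;> nlinarith
  have h5 : (2 / Real.pi * ((a - b) / 2)) ^ 2 ≤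
      Real.sin ((a + b) / 2) * Real.sin ((a - b) / 2) := by nlinarith
  have h6 : (a - b) ^ 2 = Real.pi ^ 2 * (2 / Real.pi * ((a - b) / 2)) ^ 2 := by
    field_simp
  have h7 : Real.pi ^ 2 ≤ 10 := by nlinarith [Real.pi_lt_d2, Real.pi_gt_three]
  rw [h6, h4]
  nlinarith [sq_nonneg (2 / Real.pi * ((a - b) / 2))]

theorem norm_sub_le_of_arg (z w : ℂ) :
    ‖z - w‖ ≤ |‖z‖ - ‖w‖| + ‖w‖ * |z.arg - w.arg| := by
  have hz := Complex.norm_mul_exp_arg_mul_I z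
  have hw := Complex.norm_mul_exp_arg_mul_I w
  have e : z - w = ((‖z‖ - ‖w‖ : ℝ) : ℂ) * Complex.exp (z.arg * Complex.I)
      + ‖w‖ * (Complex.exp (z.arg * Complex.I) - Complex.exp (w.arg * Complex.I)) := by
    conv_lhs => rw [← hz, ← hw]
    push_cast; ring
  rw [e]
  refine (norm_add_le _ _).trans ?_
  rw [norm_mul, norm_mul, Complex.norm_exp_ofReal_mul_I, mul_one, Complex.norm_real,
    Complex.norm_real, norm_norm, Real.norm_eq_abs]
  gcongr
  have e2 : Complex.exp (z.arg * Complex.I) - Complex.exp (w.arg * Complex.I)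
      = Complex.exp (w.arg * Complex.I) * (Complex.exp (Complex.I * ((z.arg - w.arg : ℝ) : ℂ)) - 1) := by
    rw [mul_sub, ← Complex.exp_add]; congr 2; push_cast; ring_nf
    simp
  rw [e2, norm_mul, Complex.norm_exp_ofReal_mul_I, one_mul]
  simpa using Real.norm_exp_I_mul_ofReal_sub_one_le (x := z.arg - w.arg)

open ComplexConjugate in
theorem norm_add_sq_eq (z w : ℂ) :
    ‖z + w‖ ^ 2 = ‖z‖ ^ 2 + ‖w‖ ^ 2 + 2 * (z * conj w).re := by
  simp only [← Complex.normSq_eq_norm_sq, Complex.normSq_add]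

/-- If `A² = 1 + r² + ρ² + 2P`, `B² = 1 + t² + ρ² + 2Q` and both `(A, r)` and `(B, t)` vary
boundedly, then the cosines `P / (r ρ)` and `Q / (t ρ)` are close. -/
theorem abs_cos_sub_cos_le {A B P Q r t ρ k : ℝ} (hk : 1 ≤ k) (hρ0 : 0 < ρ)
    (hx : k ≤ r ∧ r ≤ k + 1) (hy : k ≤ t ∧ t ≤ k + 1) (hAB : |A - B| ≤ 3)
    (a1 : 1 ≤ A) (a2 : 1 ≤ B) (ax : A ≤ 1 + (r + ρ)) (ay : B ≤ 1 + (t + ρ))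
    (jx : A ^ 2 = 1 + (r ^ 2 + ρ ^ 2 + 2 * P)) (jy : B ^ 2 = 1 + (t ^ 2 + ρ ^ 2 + 2 * Q))
    (hyR : |Q| ≤ t * ρ) : |P / (r * ρ) - Q / (t * ρ)| ≤ 11 / ρ + 4 / k := by
  have hrt : |r - t| ≤ 1 := by rw [abs_le]; constructor <;> linarith
  have hA : |A ^ 2 - B ^ 2| ≤ 6 * (k + 2 + ρ) := by
    rw [sq_sub_sq, abs_mul, abs_of_nonneg (by linarith : 0 ≤ A + B)]
    nlinarith [abs_nonneg (A - B)]
  have hB : |r ^ 2 - t ^ 2| ≤ 2 * k + 2 := by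
    rw [sq_sub_sq, abs_mul, abs_of_nonneg (by linarith : 0 ≤ r + t)]
    nlinarith [abs_nonneg (r - t)]
  have hPQ : |P - Q| ≤ 11 * k + 3 * ρ := by
    have e : P - Q = ((A ^ 2 - B ^ 2) - (r ^ 2 - t ^ 2)) / 2 := by linarith
    rw [abs_le] at hA hB ⊢
    rw [e]; constructor <;> linarith
  have hr : 0 < r := by linarith
  have ht : 0 < t := by linarith
  set u := P / (r * ρ) with hu
  set v := Q / (t * ρ) with hv
  have eP : P = u * (r * ρ) := by rw [hu]; field_simp
  have eQ : Q = v * (t * ρ) := by rw [hv]; field_simp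
  have hv1 : |v| ≤ 1 := by
    rw [hv, abs_div, abs_of_pos (mul_pos ht hρ0)]
    exact (div_le_one (mul_pos ht hρ0)).2 hyR
  have huv : r * ρ * |u - v| ≤ 11 * k + 4 * ρ := by
    have e : r * ρ * (u - v) = (P - Q) - ρ * (v * (r - t)) := by rw [eP, eQ]; ring
    have e1 : |ρ * (v * (r - t))| ≤ ρ := by
      rw [abs_mul, abs_mul, abs_of_pos hρ0]
      have : |v| * |r - t| ≤ 1 := mul_le_one₀ hv1 (abs_nonneg _) hrt
      nlinarith
    calc r * ρ * |u - v| = |r * ρ * (u - v)| := by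
          rw [abs_mul, abs_of_pos (mul_pos hr hρ0)]
      _ ≤ |P - Q| + |ρ * (v * (r - t))| := by rw [e]; exact abs_sub _ _
      _ ≤ _ := by linarith
  have h1 : k * ρ * |u - v| ≤ 11 * k + 4 * ρ := by
    refine le_trans ?_ huv
    have : 0 ≤ ρ * |u - v| := by positivity
    nlinarith [hx.1]
  have h2 : 11 / ρ + 4 / k = (11 * k + 4 * ρ) / (k * ρ) := by field_simp
  rw [h2, le_div_iff₀ (by positivity)]; linarith

open ComplexConjugate in
/-- On a unit annulus, the level sets of `x ↦ ⟨x + n⟩ ± ⟨x⟩` have small angular width on each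
side of the line spanned by `n`. -/
theorem abs_arg_sub_arg_le {n x y : Fin 2 → ℤ} (hn : toComplex n ≠ 0) {k : ℕ} (hk : 1 ≤ k)
    {τ c s : ℝ} (hτ : τ = -1 ∨ τ = 1) (hs : s = -1 ∨ s = 1)
    (hx : k ≤ ‖toComplex x‖ ∧ ‖toComplex x‖ ≤ k + 1) (hy : k ≤ ‖toComplex y‖ ∧ ‖toComplex y‖ ≤ k + 1)
    (hxc : |jb (x + n) + τ * jb x - c| ≤ 1) (hyc : |jb (y + n) + τ * jb y - c| ≤ 1)
    (hxs : 0 ≤ s * (toComplex x * conj (toComplex n)).arg)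
    (hys : 0 ≤ s * (toComplex y * conj (toComplex n)).arg) :
    |s * (toComplex x * conj (toComplex n)).arg - s * (toComplex y * conj (toComplex n)).arg| ≤
      8 * (1 / √‖toComplex n‖ + 1 / √k) := by
  have hk' : (1 : ℝ) ≤ k := by exact_mod_cast hk
  set ρ := ‖toComplex n‖ with hρ
  have hρ0 : 0 < ρ := norm_pos_iff.2 hn
  have hcos : ∀ t : ℝ, Real.cos (s * t) = Real.cos t := by
    intro t; rcases hs with rfl | rfl <;> simp
  have hle : ∀ z : ℂ, s * z.arg ≤ Real.pi := by
    intro z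
    have h1 := Complex.arg_le_pi z
    have h2 := Complex.neg_pi_lt_arg z
    rcases hs with rfl | rfl <;> linarith
  have hsq := sub_sq_le_of_cos hxs (hle _) hys (hle _)
  have hX : toComplex x ≠ 0 := norm_pos_iff.1 (by linarith)
  have hY : toComplex y ≠ 0 := norm_pos_iff.1 (by linarith)
  have hnc : conj (toComplex n) ≠ 0 := by simpa using hn
  rw [hcos, hcos, Complex.cos_arg (mul_ne_zero hX hnc), Complex.cos_arg (mul_ne_zero hY hnc)] at hsq
  have ex := norm_add_sq_eq (toComplex x) (toComplex n)
  have ey := norm_add_sq_eq (toComplex y) (toComplex n)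
  have hyR := Complex.abs_re_le_norm (toComplex y * conj (toComplex n))
  rw [norm_mul, Complex.norm_conj, ← hρ] at hsq hyR
  rw [norm_mul, Complex.norm_conj, ← hρ] at hsq
  rw [← toComplex_add, ← hρ] at ex ey
  set P := (toComplex x * conj (toComplex n)).re
  set Q := (toComplex y * conj (toComplex n)).re
  have jx := jb_sq (x + n)
  have jy := jb_sq (y + n)
  have ax := (jb_le_one_add_norm (x + n)).trans
    (add_le_add_right ((toComplex_add x n ▸ norm_add_le (toComplex x) (toComplex n))) 1)
  have ay := (jb_le_one_add_norm (y + n)).trans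
    (add_le_add_right ((toComplex_add y n ▸ norm_add_le (toComplex y) (toComplex n))) 1)
  rw [← hρ] at ax ay
  have bxy := abs_jb_sub_jb_le x y
  have a1 := one_le_jb (x + n)
  have a2 := one_le_jb (y + n)
  set r := ‖toComplex x‖
  set t := ‖toComplex y‖
  have hrt : |r - t| ≤ 1 := by rw [abs_le]; constructor <;> linarith
  have haa : |jb (x + n) - jb (y + n)| ≤ 3 := by
    have := abs_le.1 (bxy.trans hrt)
    rw [abs_le] at hxc hyc ⊢
    rcases hτ with rfl | rfl <;> constructor <;> linarith
  rw [ex] at jx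
  rw [ey] at jy
  have huv2 := abs_cos_sub_cos_le hk' hρ0 hx hy haa a1 a2 ax ay jx jy hyR
  set u := P / (r * ρ)
  set v := Q / (t * ρ)
  refine abs_le_of_sq_le_sq ?_ (by positivity)
  have h1 : (1 / √ρ) ^ 2 = 1 / ρ := by rw [div_pow, Real.sq_sqrt hρ0.le, one_pow]
  have h2 : (1 / √(k : ℝ)) ^ 2 = 1 / k := by rw [div_pow, Real.sq_sqrt (by linarith), one_pow]
  have h3 : 0 ≤ (1 / √ρ) * (1 / √(k : ℝ)) := by positivity
  have h4 : 0 ≤ 1 / ρ := by positivity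
  have h5 : (0 : ℝ) ≤ 1 / k := by positivity
  have h6 : 11 / ρ = 11 * (1 / ρ) := by ring
  have h7 : (4 : ℝ) / k = 4 * (1 / k) := by ring
  rw [h6, h7] at huv2
  nlinarith

open ComplexConjugate in
theorem card_half_annulus_le {n : Fin 2 → ℤ} (hn : toComplex n ≠ 0) {k : ℕ} (hk : 1 ≤ k)
    {τ c s : ℝ} (hτ : τ = -1 ∨ τ = 1) (hs : s = -1 ∨ s = 1) (S : Finset (Fin 2 → ℤ))
    (hS : ∀ x ∈ S, (k ≤ ‖toComplex x‖ ∧ ‖toComplex x‖ ≤ k + 1) ∧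
      |jb (x + n) + τ * jb x - c| ≤ 1 ∧ 0 ≤ s * (toComplex x * conj (toComplex n)).arg) :
    (S.card : ℝ) ≤ 25 * (16 * (k / √‖toComplex n‖ + √k) + 2) := by
  have hk' : (1 : ℝ) ≤ k := by exact_mod_cast hk
  have hρ0 : 0 < ‖toComplex n‖ := norm_pos_iff.2 hn
  set g : (Fin 2 → ℤ) → ℤ := fun x =>
    ⌊((k : ℝ) + 1) * (s * (toComplex x * conj (toComplex n)).arg)⌋ with hg
  have hfib : ∀ a ∈ S.image g, (S.filter (fun x => g x = a)).card ≤ 25 := by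
    intro a _
    refine card_le_of_norm_sub_le _ 2 ?_
    intro x hx y hy
    rw [Finset.mem_filter] at hx hy
    have h1 := Int.abs_sub_lt_one_of_floor_eq_floor (hx.2.trans hy.2.symm)
    obtain ⟨hx1, -, -⟩ := hS x hx.1
    obtain ⟨hy1, -, -⟩ := hS y hy.1
    have h2 := norm_sub_le_of_arg (toComplex x * conj (toComplex n))
      (toComplex y * conj (toComplex n))
    rw [← sub_mul, norm_mul, norm_mul, norm_mul, Complex.norm_conj, ← sub_mul, abs_mul,
      abs_norm] at h2
    have h3 : (k + 1) * |(toComplex x * conj (toComplex n)).arg -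
        (toComplex y * conj (toComplex n)).arg| ≤ 1 := by
      rw [← mul_sub, ← mul_sub, abs_mul, abs_mul, abs_of_nonneg (by linarith : (0 : ℝ) ≤ k + 1)] at h1
      have : |s| = 1 := by rcases hs with rfl | rfl <;> simp
      rw [this, one_mul] at h1
      exact h1.le
    set d := |(toComplex x * conj (toComplex n)).arg - (toComplex y * conj (toComplex n)).arg|
    have h4 : ‖toComplex y‖ * d ≤ 1 :=
      (mul_le_mul_of_nonneg_right hy1.2 (abs_nonneg _)).trans h3
    have h5 : |‖toComplex x‖ - ‖toComplex y‖| ≤ 1 := by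
      rw [abs_le]; constructor <;> linarith [hx1.1, hx1.2, hy1.1, hy1.2]
    push_cast
    nlinarith
  have h1 := Finset.card_le_mul_card_image S 25 hfib
  have h2 : ((S.image g).card : ℝ) ≤ ((k + 1) * (8 * (1 / √‖toComplex n‖ + 1 / √k)) + 1) + 1 := by
    refine card_int_le_of_abs_sub_le _ _ (by positivity) ?_
    simp only [Finset.mem_image, forall_exists_index, and_imp]
    rintro i x hx rfl j y hy rfl
    obtain ⟨hx1, hx2, hx3⟩ := hS x hx
    obtain ⟨hy1, hy2, hy3⟩ := hS y hy
    have h3 := abs_arg_sub_arg_le hn hk hτ hs hx1 hy1 hx2 hy2 hx3 hy3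
    have h4 := mul_le_mul_of_nonneg_left h3 (by linarith : (0 : ℝ) ≤ k + 1)
    rw [← abs_of_nonneg (by linarith : (0 : ℝ) ≤ k + 1), ← abs_mul,
      abs_of_nonneg (by linarith : (0 : ℝ) ≤ k + 1), mul_sub, abs_le] at h4
    rw [abs_le]
    simp only [hg]
    have f1 := Int.floor_le (((k : ℝ) + 1) * (s * (toComplex x * conj (toComplex n)).arg))
    have f2 := Int.lt_floor_add_one (((k : ℝ) + 1) * (s * (toComplex x * conj (toComplex n)).arg))
    have f3 := Int.floor_le (((k : ℝ) + 1) * (s * (toComplex y * conj (toComplex n)).arg))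
    have f4 := Int.lt_floor_add_one (((k : ℝ) + 1) * (s * (toComplex y * conj (toComplex n)).arg))
    constructor <;> linarith [h4.1, h4.2]
  have h3 : (S.card : ℝ) ≤ 25 * ((S.image g).card : ℝ) := by exact_mod_cast h1
  have h4 : (k : ℝ) * (1 / √k) = √k := by
    rw [mul_one_div, Real.div_sqrt]
  have h5 : (k + 1) * (8 * (1 / √‖toComplex n‖ + 1 / √k)) ≤ 16 * (k / √‖toComplex n‖ + √k) := by
    have h6 : 0 ≤ 1 / √‖toComplex n‖ + 1 / √(k : ℝ) := by positivity
    have h7 : k / √‖toComplex n‖ + √k = k * (1 / √‖toComplex n‖ + 1 / √k) := by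
      rw [mul_add, h4]; ring
    rw [h7]; nlinarith
  linarith

open ComplexConjugate in
theorem card_annulus_le {n : Fin 2 → ℤ} (hn : toComplex n ≠ 0) {k : ℕ} (hk : 1 ≤ k)
    {τ c : ℝ} (hτ : τ = -1 ∨ τ = 1) (S : Finset (Fin 2 → ℤ))
    (hS : ∀ x ∈ S, (k ≤ ‖toComplex x‖ ∧ ‖toComplex x‖ ≤ k + 1) ∧
      |jb (x + n) + τ * jb x - c| ≤ 1) :
    (S.card : ℝ) ≤ 900 * (k / √‖toComplex n‖ + √k) := by
  classical
  have hk' : (1 : ℝ) ≤ √k := by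
    rw [Real.one_le_sqrt]; exact_mod_cast hk
  have h0 : 0 ≤ k / √‖toComplex n‖ := by positivity
  rw [← Finset.card_filter_add_card_filter_not
    (p := fun x => 0 ≤ (toComplex x * conj (toComplex n)).arg)]
  have h1 := card_half_annulus_le hn hk (c := c) hτ (Or.inr rfl)
    (S.filter (fun x => 0 ≤ (toComplex x * conj (toComplex n)).arg)) (by
      intro x hx
      rw [Finset.mem_filter] at hx
      exact ⟨(hS x hx.1).1, (hS x hx.1).2, by linarith [hx.2]⟩)
  have h2 := card_half_annulus_le hn hk (c := c) hτ (Or.inl rfl)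
    (S.filter (fun x => ¬ 0 ≤ (toComplex x * conj (toComplex n)).arg)) (by
      intro x hx
      rw [Finset.mem_filter] at hx
      exact ⟨(hS x hx.1).1, (hS x hx.1).2, by linarith [hx.2]⟩)
  push_cast
  linarith

/-- Lattice points in a disc near a level set of `x ↦ ⟨x + n⟩ ± ⟨x⟩`. -/
theorem card_level_le {n : Fin 2 → ℤ} {R : ℝ} (hR : 1 ≤ R)
    {τ c : ℝ} (hτ : τ = -1 ∨ τ = 1) (S : Finset (Fin 2 → ℤ))
    (hS : ∀ x ∈ S, ‖toComplex x‖ ≤ R ∧ |jb (x + n) + τ * jb x - c| ≤ 1) :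
    (S.card : ℝ) ≤ 4000 * (R ^ 2 * (1 / √R + 1 / √(jb n))) := by
  have hsR : R ^ 2 * (1 / √R) = R * √R := by
    rw [sq, mul_assoc, mul_one_div, Real.div_sqrt]
  have hsR1 : 1 ≤ √R := by rwa [Real.one_le_sqrt]
  by_cases hn : toComplex n = 0
  · have hj : jb n = 1 := by
      have := jb_sq n
      rw [hn, norm_zero] at this
      nlinarith [one_le_jb n]
    have h1 := card_le_of_norm_sub_le S ⌈2 * R⌉₊ (by
      intro x hx y hy
      refine ((norm_sub_le _ _).trans ?_).trans (Nat.le_ceil _)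
      linarith [(hS x hx).1, (hS y hy).1])
    have h2 : (S.card : ℝ) ≤ (2 * ⌈2 * R⌉₊ + 1) ^ 2 := by exact_mod_cast h1
    have h3 := (Nat.ceil_lt_add_one (by linarith : 0 ≤ 2 * R)).le
    have h4 : (0 : ℝ) ≤ ⌈2 * R⌉₊ := by positivity
    rw [hj, mul_add, hsR, Real.sqrt_one]
    nlinarith
  · set ρ := ‖toComplex n‖ with hρ
    have hρ1 : 1 ≤ ρ := by
      have hρ0 : 0 < ρ ^ 2 := pow_pos (norm_pos_iff.2 hn) 2
      rw [hρ, norm_toComplex_sq] at hρ0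
      have h1 : (0 : ℤ) < n 0 ^ 2 + n 1 ^ 2 := by exact_mod_cast hρ0
      have h2 : (1 : ℤ) ≤ n 0 ^ 2 + n 1 ^ 2 := h1
      have h3 : (1 : ℝ) ≤ ρ ^ 2 := by rw [hρ, norm_toComplex_sq]; exact_mod_cast h2
      exact (one_le_sq_iff₀ (norm_nonneg _)).1 h3
    have hρj : 1 / √ρ ≤ 2 * (1 / √(jb n)) := by
      have h1 : jb n ≤ 4 * ρ := by linarith [jb_le_one_add_norm n]
      have h2 : √(jb n) ≤ 2 * √ρ := by
        rw [show (2 : ℝ) = √4 by rw [show (4 : ℝ) = 2 ^ 2 by norm_num]; simp,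
          ← Real.sqrt_mul (by norm_num)]
        exact Real.sqrt_le_sqrt h1
      have h3 : 0 < √ρ := Real.sqrt_pos.2 (by linarith)
      have h4 : 0 < √(jb n) := Real.sqrt_pos.2 (by linarith [one_le_jb n])
      rw [mul_one_div, div_le_div_iff₀ h3 h4]; linarith
    set g : (Fin 2 → ℤ) → ℕ := fun x => ⌊‖toComplex x‖⌋₊ with hg
    set K := R / √ρ + √R with hK
    have hK1 : 1 ≤ K := by
      have : 0 ≤ R / √ρ := by positivity
      linarith
    have hfib : ∀ a ∈ Finset.range (⌊R⌋₊ + 1), ((S.filter (fun x => g x = a)).card : ℝ) ≤ 900 * K := by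
      intro a ha
      have hfl : ∀ x, g x = a → a ≤ ‖toComplex x‖ ∧ ‖toComplex x‖ ≤ a + 1 := by
        rintro x rfl
        exact ⟨Nat.floor_le (norm_nonneg _), (Nat.lt_floor_add_one _).le⟩
      rcases Nat.eq_zero_or_pos a with h0 | h0
      · have := card_le_of_norm_sub_le (S.filter (fun x => g x = a)) 2 (by
          intro x hx y hy
          rw [Finset.mem_filter] at hx hy
          have h1 := (hfl x hx.2).2
          have h2 := (hfl y hy.2).2
          rw [h0, Nat.cast_zero] at h1 h2
          refine (norm_sub_le _ _).trans ?_
          push_cast; linarith)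
        have h3 : ((S.filter (fun x => g x = a)).card : ℝ) ≤ 25 := by exact_mod_cast this
        linarith
      · refine (card_annulus_le hn h0 hτ (S.filter (fun x => g x = a)) (c := c) ?_).trans ?_
        · intro x hx
          rw [Finset.mem_filter] at hx
          exact ⟨hfl x hx.2, (hS x hx.1).2⟩
        · have haR : (a : ℝ) ≤ R := by
            rw [Finset.mem_range] at ha
            exact (Nat.le_floor_iff (by linarith)).1 (by omega)
          rw [hK]; gcongr
    have h1 : S.card = ∑ a ∈ Finset.range (⌊R⌋₊ + 1), (S.filter (fun x => g x = a)).card := by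
      refine Finset.card_eq_sum_card_fiberwise ?_
      intro x hx
      simp only [Finset.coe_range, Set.mem_Iio]
      exact Nat.lt_succ_of_le (Nat.floor_le_floor (hS x hx).1)
    have h2 : (S.card : ℝ) ≤ (⌊R⌋₊ + 1) * (900 * K) := by
      rw [h1]; push_cast
      refine (Finset.sum_le_sum hfib).trans (le_of_eq ?_)
      simp
    have h3 := Nat.floor_le (by linarith : 0 ≤ R)
    have h4 : (⌊R⌋₊ + 1) * (900 * K) ≤ 1800 * (R * K) := by nlinarith
    have h5 : R * K = R ^ 2 * (1 / √ρ) + R * √R := by rw [hK]; ring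
    have h6 : R ^ 2 * (1 / √ρ) ≤ R ^ 2 * (2 * (1 / √(jb n))) := by gcongr
    have h7 : 0 ≤ R * √R := by positivity
    rw [mul_add, hsR]
    nlinarith

theorem card_phase_level_le {n : Fin 2 → ℤ} {R : ℝ} (hR : 1 ≤ R)
    {σ τ c : ℝ} (hσ : σ = -1 ∨ σ = 1) (hτ : τ = -1 ∨ τ = 1) (S : Finset (Fin 2 → ℤ))
    (hS : ∀ x ∈ S, ‖toComplex x‖ ≤ R ∧ |σ * jb (x + n) + τ * jb x - c| ≤ 1) :
    (S.card : ℝ) ≤ 4000 * (R ^ 2 * (1 / √R + 1 / √(jb n))) := by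
  rcases hσ with rfl | rfl
  · refine card_level_le hR (τ := -τ) (c := -c) (by rcases hτ with rfl | rfl <;> simp) S ?_
    intro x hx
    refine ⟨(hS x hx).1, ?_⟩
    rw [← abs_neg]
    convert (hS x hx).2 using 2
    ring
  · exact card_level_le hR hτ S (by simpa using hS)

theorem sum_one_div_nat_le (M : Finset ℕ) {L : ℝ} (hL : 0 ≤ L)
    (h : ∀ i ∈ M, ∀ j ∈ M, (i : ℝ) ≤ j + L) :
    ∑ i ∈ M, (1 + (i : ℝ))⁻¹ ≤ 3 * Real.log (2 + L) := by
  have hlog : (1 / 2 : ℝ) ≤ Real.log (2 + L) :=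
    (by linarith [Real.log_two_gt_d9] : (1 / 2 : ℝ) ≤ Real.log 2).trans
      (Real.log_le_log (by norm_num) (by linarith))
  rcases M.eq_empty_or_nonempty with rfl | hM
  · simp; linarith
  set m₀ := M.min' hM with hm
  have hinj : Set.InjOn (fun i => i - m₀) (M : Set ℕ) := by
    intro i hi j hj hij
    have h1 : m₀ ≤ i := M.min'_le i hi
    have h2 : m₀ ≤ j := M.min'_le j hj
    simp only at hij
    omega
  calc ∑ i ∈ M, (1 + (i : ℝ))⁻¹ ≤ ∑ i ∈ M, (1 + ((i - m₀ : ℕ) : ℝ))⁻¹ := by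
        refine Finset.sum_le_sum fun i _ => ?_
        have : ((i - m₀ : ℕ) : ℝ) ≤ i := by exact_mod_cast Nat.sub_le _ _
        gcongr
    _ = ∑ j ∈ M.image (fun i => i - m₀), (1 + (j : ℝ))⁻¹ :=
        (Finset.sum_image (f := fun j : ℕ => (1 + (j : ℝ))⁻¹) hinj).symm
    _ ≤ ∑ j ∈ Finset.range (⌊L⌋₊ + 1), (1 + (j : ℝ))⁻¹ := by
        refine Finset.sum_le_sum_of_subset_of_nonneg ?_ (fun _ _ _ => by positivity)
        intro j hj
        obtain ⟨i, hi, rfl⟩ := Finset.mem_image.1 hj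
        rw [Finset.mem_range]
        refine Nat.lt_succ_of_le (Nat.le_floor ?_)
        rw [Nat.cast_sub (M.min'_le i hi)]
        linarith [h i hi m₀ (M.min'_mem hM)]
    _ = ((harmonic (⌊L⌋₊ + 1) : ℚ) : ℝ) := by
        rw [harmonic]; push_cast
        exact Finset.sum_congr rfl fun j _ => by rw [add_comm]
    _ ≤ 1 + Real.log ((⌊L⌋₊ + 1 : ℕ) : ℝ) := harmonic_le_one_add_log _
    _ ≤ 1 + Real.log (2 + L) := by
        gcongr
        push_cast
        linarith [Nat.floor_le hL]
    _ ≤ 3 * Real.log (2 + L) := by linarith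

theorem inv_sqrt_one_add_sq_le (m : ℤ) :
    (√(1 + (m : ℝ) ^ 2))⁻¹ ≤ 2 * (1 + (m.natAbs : ℝ))⁻¹ := by
  have h0 : (m.natAbs : ℝ) = |(m : ℝ)| := by
    rw [Nat.cast_natAbs]; simp
  have h1 : (1 + (m.natAbs : ℝ)) / 2 ≤ √(1 + (m : ℝ) ^ 2) := by
    apply Real.le_sqrt_of_sq_le
    rw [h0, ← sq_abs (m : ℝ)]
    nlinarith [sq_nonneg (|(m : ℝ)| - 1)]
  refine (inv_anti₀ (by positivity) h1).trans (le_of_eq ?_)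
  rw [inv_div]; ring

theorem sum_inv_sqrt_le (M : Finset ℤ) {L : ℝ} (hL : 0 ≤ L)
    (h : ∀ i ∈ M, ∀ j ∈ M, |(i : ℝ) - j| ≤ L) :
    ∑ m ∈ M, (√(1 + (m : ℝ) ^ 2))⁻¹ ≤ 12 * Real.log (2 + L) := by
  have key : ∀ M' ⊆ M, Set.InjOn Int.natAbs (M' : Set ℤ) →
      (∀ i ∈ M', ∀ j ∈ M', |(i.natAbs : ℝ) - j.natAbs| ≤ |(i : ℝ) - j|) →
      ∑ m ∈ M', (√(1 + (m : ℝ) ^ 2))⁻¹ ≤ 6 * Real.log (2 + L) := by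
    intro M' hM' hinj hd
    have h1 := sum_one_div_nat_le (M'.image Int.natAbs) hL (by
      simp only [Finset.mem_image, forall_exists_index, and_imp]
      rintro _ i hi rfl _ j hj rfl
      have := (le_abs_self _).trans ((hd i hi j hj).trans (h i (hM' hi) j (hM' hj)))
      linarith)
    rw [Finset.sum_image hinj] at h1
    refine (Finset.sum_le_sum fun m _ => inv_sqrt_one_add_sq_le m).trans ?_
    rw [← Finset.mul_sum]; linarith
  have hd : ∀ i j : ℤ, |(i.natAbs : ℝ) - j.natAbs| ≤ |(i : ℝ) - j| := by
    intro i j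
    simp only [Nat.cast_natAbs, Int.cast_abs]
    exact abs_abs_sub_abs_le _ _
  rw [← Finset.sum_filter_add_sum_filter_not M (fun m => 0 ≤ m)]
  have h1 := key (M.filter (fun m => 0 ≤ m)) (Finset.filter_subset _ _) (by
    intro i hi j hj hij
    rw [Finset.mem_coe, Finset.mem_filter] at hi hj
    omega) (fun i _ j _ => hd i j)
  have h2 := key (M.filter (fun m => ¬ 0 ≤ m)) (Finset.filter_subset _ _) (by
    intro i hi j hj hij
    rw [Finset.mem_coe, Finset.mem_filter] at hi hj
    omega) (fun i _ j _ => hd i j)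
  linarith

open Classical in
theorem sum_card_phase_level_le {n : Fin 2 → ℤ} {R : ℝ} (hR : 1 ≤ R)
    {σ τ : ℝ} (K : ℝ) (hσ : σ = -1 ∨ σ = 1) (hτ : τ = -1 ∨ τ = 1) (M : Finset ℤ)
    (S : Finset (Fin 2 → ℤ)) (hS : ∀ x ∈ S, ‖toComplex x‖ ≤ R) :
    ∑ m ∈ M, (√(1 + (m : ℝ) ^ 2))⁻¹ *
      ((S.filter (fun x => |σ * jb (x + n) + τ * jb x + K - m| ≤ 1)).card : ℝ) ≤
      48000 * Real.log (2 + 6 * R) * (R ^ 2 * (1 / √R + 1 / √(jb n))) := by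
  set F : ℤ → Finset (Fin 2 → ℤ) := fun m =>
    S.filter (fun x => |σ * jb (x + n) + τ * jb x + K - m| ≤ 1) with hF
  have hcard : ∀ m, ((F m).card : ℝ) ≤ 4000 * (R ^ 2 * (1 / √R + 1 / √(jb n))) := by
    intro m
    refine card_phase_level_le hR hσ hτ (c := m - K) (F m) ?_
    intro x hx
    simp only [hF, Finset.mem_filter] at hx
    refine ⟨hS x hx.1, ?_⟩
    convert hx.2 using 2
    ring
  have hsum := sum_inv_sqrt_le (M.filter (fun m => (F m).Nonempty)) (L := 6 * R) (by linarith) (by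
    intro i hi j hj
    rw [Finset.mem_filter] at hi hj
    obtain ⟨x, hx⟩ := hi.2
    obtain ⟨y, hy⟩ := hj.2
    simp only [hF, Finset.mem_filter] at hx hy
    have h1 := (norm_sub_le (toComplex x) (toComplex y)).trans
      (add_le_add (hS x hx.1) (hS y hy.1))
    have h2 := (abs_jb_sub_jb_le_norm_sub x y).trans h1
    have h3 : |jb (x + n) - jb (y + n)| ≤ R + R := by
      refine (abs_jb_sub_jb_le_norm_sub _ _).trans (le_trans (le_of_eq ?_) h1)
      rw [toComplex_add, toComplex_add]; congr 1; ring
    have hx2 := abs_le.1 hx.2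
    have hy2 := abs_le.1 hy.2
    rw [abs_le] at h2 h3 ⊢
    rcases hσ with rfl | rfl <;> rcases hτ with rfl | rfl <;> constructor <;> linarith)
  have hB : 0 ≤ R ^ 2 * (1 / √R + 1 / √(jb n)) := by positivity
  calc ∑ m ∈ M, (√(1 + (m : ℝ) ^ 2))⁻¹ * ((F m).card : ℝ)
      = ∑ m ∈ M.filter (fun m => (F m).Nonempty),
          (√(1 + (m : ℝ) ^ 2))⁻¹ * ((F m).card : ℝ) := by
        rw [Finset.sum_filter]
        refine Finset.sum_congr rfl fun m _ => ?_
        split_ifs with h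
        · rfl
        · rw [Finset.not_nonempty_iff_eq_empty.1 h]; simp
    _ ≤ ∑ m ∈ M.filter (fun m => (F m).Nonempty),
          (√(1 + (m : ℝ) ^ 2))⁻¹ * (4000 * (R ^ 2 * (1 / √R + 1 / √(jb n)))) := by
        refine Finset.sum_le_sum fun m _ => ?_
        exact mul_le_mul_of_nonneg_left (hcard m) (by positivity)
    _ ≤ _ := by
        rw [← Finset.sum_mul]
        nlinarith

open Classical in
theorem sum_card_phase_level_translate_le {n : Fin 2 → ℤ} {R : ℝ} (hR : 1 ≤ R)
    {σ τ : ℝ} (K : ℝ) (hσ : σ = -1 ∨ σ = 1) (hτ : τ = -1 ∨ τ = 1) (M : Finset ℤ)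
    (S : Finset (Fin 2 → ℤ)) (hS : ∀ x ∈ S, ‖toComplex (x + n)‖ ≤ R) :
    ∑ m ∈ M, (√(1 + (m : ℝ) ^ 2))⁻¹ *
      ((S.filter (fun x => |σ * jb (x + n) + τ * jb x + K - m| ≤ 1)).card : ℝ) ≤
      48000 * Real.log (2 + 6 * R) * (R ^ 2 * (1 / √R + 1 / √(jb n))) := by
  have h := sum_card_phase_level_le (n := -n) hR K hτ hσ M (S.image (fun x => x + n)) (by
    intro y hy
    obtain ⟨x, hx, rfl⟩ := Finset.mem_image.1 hy
    exact hS x hx)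
  rw [jb_neg] at h
  refine le_trans (le_of_eq ?_) h
  refine Finset.sum_congr rfl fun m _ => ?_
  rw [Finset.filter_image, Finset.card_image_of_injective _ (add_left_injective n)]
  congr 4
  ext x
  rw [add_neg_cancel_right, add_comm (τ * jb x)]

theorem inv_le_dyadic_sum {a : ℝ} (ha : 1 ≤ a) {J : ℕ} (hJ : a ≤ 2 ^ J) :
    a⁻¹ ≤ 2 * ∑ j ∈ Finset.range (J + 1), ((2 : ℝ) ^ j)⁻¹ * (if a ≤ 2 ^ j then 1 else 0) := by
  have hnn : ∀ j ∈ Finset.range (J + 1),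
      (0 : ℝ) ≤ ((2 : ℝ) ^ j)⁻¹ * (if a ≤ 2 ^ j then 1 else 0) := by
    intro j _; split_ifs <;> positivity
  obtain ⟨i, hi1, hi2⟩ := exists_nat_pow_near ha (one_lt_two)
  have key : ∀ j ≤ J, a ≤ 2 ^ j → a⁻¹ ≤ 2 * ((2 : ℝ) ^ j)⁻¹ → a⁻¹ ≤
      2 * ∑ j ∈ Finset.range (J + 1), ((2 : ℝ) ^ j)⁻¹ * (if a ≤ 2 ^ j then 1 else 0) := by
    intro j hj haj h
    have := Finset.single_le_sum hnn (Finset.mem_range.2 (Nat.lt_succ_of_le hj))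
    rw [if_pos haj, mul_one] at this
    linarith
  rcases Nat.lt_or_ge i J with h | h
  · refine key (i + 1) h hi2.le ?_
    have : 2 * ((2 : ℝ) ^ (i + 1))⁻¹ = ((2 : ℝ) ^ i)⁻¹ := by
      rw [pow_succ, mul_inv]; ring
    rw [this]
    exact inv_anti₀ (by positivity) hi1
  · refine key J le_rfl hJ ?_
    have h1 : (2 : ℝ) ^ J ≤ a := (pow_le_pow_right₀ one_le_two h).trans hi1
    have h2 := inv_anti₀ (by positivity) h1
    have : 0 < ((2 : ℝ) ^ J)⁻¹ := by positivity
    linarith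

theorem sum_sqrt_two_pow_le (n : ℕ) :
    ∑ j ∈ Finset.range n, √((2 : ℝ) ^ j) ≤ 3 * √((2 : ℝ) ^ n) := by
  induction n with
  | zero => simp
  | succ n ih =>
    rw [Finset.sum_range_succ, pow_succ, Real.sqrt_mul (by positivity)]
    have h1 : (4 / 3 : ℝ) ≤ √2 := Real.le_sqrt_of_sq_le (by norm_num)
    nlinarith [Real.sqrt_nonneg ((2 : ℝ) ^ n)]

theorem sum_two_pow_le (n : ℕ) : ∑ j ∈ Finset.range n, (2 : ℝ) ^ j ≤ 2 ^ n := by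
  rw [geom_sum_eq (by norm_num)]; norm_num

/-- The region where `⟨n⟩` dominates `N`. -/
theorem rpow_mul_inv_le_of_le {α N B : ℝ} (hN : 1 ≤ N) (hNB : N ≤ B) :
    N ^ (-2 + 2 * α) * (N ^ 2 * (1 / √N)) * B⁻¹ ≤ B ^ (-(sTildeAlpha α)) := by
  have hN0 : 0 < N := by linarith
  have hB0 : 0 < B := by linarith
  have e : N ^ (-2 + 2 * α) * (N ^ 2 * (1 / √N)) = N ^ (2 * α - 1 / 2) := by
    rw [Real.sqrt_eq_rpow, one_div (N ^ _), ← Real.rpow_neg hN0.le, ← Real.rpow_natCast N 2,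
      ← Real.rpow_add hN0, ← Real.rpow_add hN0]
    congr 1; push_cast; ring
  rw [e, sTildeAlpha]
  split_ifs with h
  · rw [Real.rpow_neg hB0.le, Real.rpow_one]
    have : N ^ (2 * α - 1 / 2) ≤ 1 := Real.rpow_le_one_of_one_le_of_nonpos hN (by linarith)
    have hBi : 0 ≤ B⁻¹ := by positivity
    nlinarith
  · have h1 : N ^ (2 * α - 1 / 2) ≤ B ^ (2 * α - 1 / 2) :=
      Real.rpow_le_rpow hN0.le hNB (by linarith)
    have h2 : B ^ (-(3 / 2 - 2 * α)) = B ^ (2 * α - 1 / 2) * B⁻¹ := by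
      rw [← Real.rpow_neg_one B, ← Real.rpow_add hB0]; congr 1; ring
    rw [h2]
    gcongr

/-- The region where `N` dominates `⟨n⟩`. -/
theorem rpow_mul_inv_sqrt_le_of_le {α N B : ℝ} (hα0 : 0 < α) (hα1 : α < 1 / 2) (hB : 1 ≤ B)
    (hBN : B ≤ 5 * N) :
    N ^ (-2 + 2 * α) * (N * (1 / √B)) ≤ 5 * B ^ (-(sTildeAlpha α)) := by
  have hB0 : 0 < B := by linarith
  have hN0 : 0 < N := by linarith
  have e : N ^ (-2 + 2 * α) * N = N ^ (-1 + 2 * α) := by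
    nth_rw 2 [← Real.rpow_one N]
    rw [← Real.rpow_add hN0]; congr 1; ring
  have h1 : N ^ (-1 + 2 * α) ≤ 5 * B ^ (-1 + 2 * α) := by
    have h2 : N ^ (-1 + 2 * α) ≤ (B / 5) ^ (-1 + 2 * α) :=
      Real.rpow_le_rpow_of_nonpos (by linarith) (by linarith) (by linarith)
    have h3 : (B / 5) ^ (-1 + 2 * α) = B ^ (-1 + 2 * α) * 5 ^ (1 - 2 * α) := by
      rw [Real.div_rpow hB0.le (by norm_num), div_eq_mul_inv,
        ← Real.rpow_neg (by norm_num : (0 : ℝ) ≤ 5)]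
      congr 2; ring
    have h4 : (5 : ℝ) ^ (1 - 2 * α) ≤ 5 := by
      conv_rhs => rw [← Real.rpow_one 5]
      exact Real.rpow_le_rpow_of_exponent_le (by norm_num) (by linarith)
    have h5 : 0 ≤ B ^ (-1 + 2 * α) := by positivity
    rw [h3] at h2
    nlinarith
  have h6 : B ^ (-1 + 2 * α) * (1 / √B) = B ^ (-3 / 2 + 2 * α) := by
    rw [Real.sqrt_eq_rpow, one_div (B ^ _), ← Real.rpow_neg hB0.le, ← Real.rpow_add hB0]
    congr 1; ring
  have h7 : B ^ (-3 / 2 + 2 * α) ≤ B ^ (-(sTildeAlpha α)) := by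
    refine Real.rpow_le_rpow_of_exponent_le hB ?_
    rw [sTildeAlpha]; split_ifs <;> linarith
  calc N ^ (-2 + 2 * α) * (N * (1 / √B)) = N ^ (-1 + 2 * α) * (1 / √B) := by rw [← e]; ring
    _ ≤ 5 * B ^ (-1 + 2 * α) * (1 / √B) := by gcongr
    _ = 5 * B ^ (-3 / 2 + 2 * α) := by rw [mul_assoc, h6]
    _ ≤ _ := by linarith

theorem jb_rpow_le {α N : ℝ} (hα0 : 0 < α) (hα1 : α < 1 / 2) (hN : 1 ≤ N) {x : Fin 2 → ℤ}
    (hx : N / 2 ≤ ‖toComplex x‖) : jb x ^ (-2 + 2 * α) ≤ 4 * N ^ (-2 + 2 * α) := by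
  have h1 : jb x ^ (-2 + 2 * α) ≤ (N / 2) ^ (-2 + 2 * α) :=
    Real.rpow_le_rpow_of_nonpos (by linarith) (hx.trans (norm_le_jb x)) (by linarith)
  have h3 : (N / 2) ^ (-2 + 2 * α) = N ^ (-2 + 2 * α) * 2 ^ (2 - 2 * α) := by
    rw [Real.div_rpow (by linarith) (by norm_num), div_eq_mul_inv,
      ← Real.rpow_neg (by norm_num : (0 : ℝ) ≤ 2)]
    congr 2; ring
  have h4 : (2 : ℝ) ^ (2 - 2 * α) ≤ 4 := by
    rw [show (4 : ℝ) = 2 ^ (2 : ℝ) by norm_num]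
    exact Real.rpow_le_rpow_of_exponent_le (by norm_num) (by linarith)
  have h5 : 0 ≤ N ^ (-2 + 2 * α) := Real.rpow_nonneg (by linarith) _
  rw [h3] at h1
  nlinarith

theorem log_two_add_le {N : ℝ} (hN : 1 ≤ N) : Real.log (2 + 48 * N) ≤ 5 * Real.log (2 + N) := by
  rw [← Real.log_rpow (by linarith)]
  refine Real.log_le_log (by linarith) ?_
  rw [show (5 : ℝ) = ((5 : ℕ) : ℝ) by norm_num, Real.rpow_natCast]
  have : (2 + N) ^ 5 = 32 + 80 * N + N ^ 2 * (80 + 40 * N + 10 * N ^ 2 + N ^ 3) := by ring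
  rw [this]
  have : 0 ≤ N ^ 2 * (80 + 40 * N + 10 * N ^ 2 + N ^ 3) := by positivity
  linarith

open Classical in
theorem sum_resonance_le_of_le {α : ℝ} (hα0 : 0 < α) (hα1 : α < 1 / 2) {σ τ : ℝ} (K : ℝ)
    (hσ : σ = -1 ∨ σ = 1) (hτ : τ = -1 ∨ τ = 1) {n : Fin 2 → ℤ} {N : ℝ} (hN : 1 ≤ N)
    (hn : 4 * N ≤ ‖toComplex n‖) (M : Finset ℤ) (A : Finset (Fin 2 → ℤ))
    (hA : ∀ x ∈ A, N / 2 ≤ ‖toComplex x‖ ∧ ‖toComplex x‖ ≤ 2 * N) :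
    ∑ m ∈ M, (√(1 + (m : ℝ) ^ 2))⁻¹ *
      ∑ x ∈ A.filter (fun x => |σ * jb (x + n) + τ * jb x + K - m| ≤ 1),
        (jb (x + n))⁻¹ * jb x ^ (-2 + 2 * α) ≤
      10 ^ 9 * Real.log (2 + N) * jb n ^ (-(sTildeAlpha α)) := by
  have hB := one_le_jb n
  have hNB : N ≤ jb n := by linarith [norm_le_jb n]
  have hl := log_two_add_le hN
  have hl1 : Real.log (2 + 6 * (2 * N)) ≤ Real.log (2 + 48 * N) :=
    Real.log_le_log (by linarith) (by linarith)
  have hl0 : 0 ≤ Real.log (2 + N) := Real.log_nonneg (by linarith)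
  set W := N ^ (-2 + 2 * α) with hW
  have hW0 : 0 ≤ W := Real.rpow_nonneg (by linarith) _
  have hw : ∀ x ∈ A, (jb (x + n))⁻¹ * jb x ^ (-2 + 2 * α) ≤ 16 * W * (jb n)⁻¹ := by
    intro x hx
    have h1 : jb n / 4 ≤ jb (x + n) := by
      have h2 := norm_sub_le (toComplex (x + n)) (toComplex x)
      rw [← toComplex_sub, add_sub_cancel_left] at h2
      linarith [norm_le_jb (x + n), jb_le_one_add_norm n, (hA x hx).2]
    have h3 := inv_anti₀ (by linarith) h1
    rw [inv_div] at h3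
    have h4 := jb_rpow_le hα0 hα1 hN (hA x hx).1
    have h5 : 0 ≤ jb x ^ (-2 + 2 * α) := Real.rpow_nonneg (by linarith [one_le_jb x]) _
    calc (jb (x + n))⁻¹ * jb x ^ (-2 + 2 * α) ≤ 4 / jb n * (4 * W) :=
          mul_le_mul h3 h4 h5 (by positivity)
      _ = _ := by ring
  have hsum := sum_card_phase_level_le (by linarith : 1 ≤ 2 * N) K hσ hτ (n := n) M A
    (fun x hx => (hA x hx).2)
  have hsq1 : 1 / √(2 * N) ≤ 1 / √N :=
    one_div_le_one_div_of_le (Real.sqrt_pos.2 (by linarith)) (Real.sqrt_le_sqrt (by linarith))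
  have hsq2 : 1 / √(jb n) ≤ 1 / √N :=
    one_div_le_one_div_of_le (Real.sqrt_pos.2 (by linarith)) (Real.sqrt_le_sqrt hNB)
  calc _ ≤ ∑ m ∈ M, (√(1 + (m : ℝ) ^ 2))⁻¹ *
        ((A.filter (fun x => |σ * jb (x + n) + τ * jb x + K - m| ≤ 1)).card *
          (16 * W * (jb n)⁻¹)) := by
        refine Finset.sum_le_sum fun m _ => ?_
        refine mul_le_mul_of_nonneg_left ?_ (by positivity)
        rw [← nsmul_eq_mul]
        exact Finset.sum_le_card_nsmul _ _ _ fun x hx => hw x (Finset.mem_filter.1 hx).1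
    _ = (∑ m ∈ M, (√(1 + (m : ℝ) ^ 2))⁻¹ *
        ((A.filter (fun x => |σ * jb (x + n) + τ * jb x + K - m| ≤ 1)).card : ℝ)) *
          (16 * W * (jb n)⁻¹) := by
        rw [Finset.sum_mul]
        exact Finset.sum_congr rfl fun m _ => by ring
    _ ≤ (48000 * (5 * Real.log (2 + N)) * ((2 * N) ^ 2 * (1 / √N + 1 / √N))) *
          (16 * W * (jb n)⁻¹) := by
        refine mul_le_mul_of_nonneg_right (hsum.trans ?_) (by positivity)
        gcongr
        exact hl1.trans hl
    _ = 30720000 * Real.log (2 + N) * (W * (N ^ 2 * (1 / √N)) * (jb n)⁻¹) := by ring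
    _ ≤ 30720000 * Real.log (2 + N) * jb n ^ (-(sTildeAlpha α)) := by
        have := rpow_mul_inv_le_of_le (α := α) hN hNB
        gcongr
    _ ≤ _ := by
        have : 0 ≤ Real.log (2 + N) * jb n ^ (-(sTildeAlpha α)) :=
          mul_nonneg hl0 (Real.rpow_nonneg (by linarith) _)
        linarith

open Classical in
theorem sum_resonance_le_of_ge {α : ℝ} (hα0 : 0 < α) (hα1 : α < 1 / 2) {σ τ : ℝ} (K : ℝ)
    (hσ : σ = -1 ∨ σ = 1) (hτ : τ = -1 ∨ τ = 1) {n : Fin 2 → ℤ} (k : ℕ)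
    (hn : ‖toComplex n‖ ≤ 4 * 2 ^ k) (M : Finset ℤ) (A : Finset (Fin 2 → ℤ))
    (hA : ∀ x ∈ A, (2 : ℝ) ^ k / 2 ≤ ‖toComplex x‖ ∧ ‖toComplex x‖ ≤ 2 * 2 ^ k) :
    ∑ m ∈ M, (√(1 + (m : ℝ) ^ 2))⁻¹ *
      ∑ x ∈ A.filter (fun x => |σ * jb (x + n) + τ * jb x + K - m| ≤ 1),
        (jb (x + n))⁻¹ * jb x ^ (-2 + 2 * α) ≤
      10 ^ 9 * Real.log (2 + 2 ^ k) * jb n ^ (-(sTildeAlpha α)) := by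
  have hN : (1 : ℝ) ≤ 2 ^ k := one_le_pow₀ one_le_two
  set N : ℝ := 2 ^ k with hNdef
  have hB := one_le_jb n
  have hBN : jb n ≤ 5 * N := by linarith [jb_le_one_add_norm n]
  have hl := log_two_add_le hN
  have hl0 : 0 ≤ Real.log (2 + N) := Real.log_nonneg (by linarith)
  set W := N ^ (-2 + 2 * α) with hW
  have hW0 : 0 ≤ W := Real.rpow_nonneg (by linarith) _
  set F : ℤ → Finset (Fin 2 → ℤ) := fun m =>
    A.filter (fun x => |σ * jb (x + n) + τ * jb x + K - m| ≤ 1) with hF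
  have h8 : (2 : ℝ) ^ (k + 3) = 8 * N := by rw [pow_add]; ring
  have hw : ∀ x ∈ A, (jb (x + n))⁻¹ * jb x ^ (-2 + 2 * α) ≤ 8 * W *
      ∑ j ∈ Finset.range (k + 4), ((2 : ℝ) ^ j)⁻¹ * (if jb (x + n) ≤ 2 ^ j then 1 else 0) := by
    intro x hx
    have h1 : jb (x + n) ≤ 2 ^ (k + 3) := by
      have h2 := norm_add_le (toComplex x) (toComplex n)
      rw [← toComplex_add] at h2
      rw [h8]
      linarith [jb_le_one_add_norm (x + n), (hA x hx).2]
    have h3 := inv_le_dyadic_sum (one_le_jb (x + n)) h1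
    have h4 := jb_rpow_le hα0 hα1 hN (hA x hx).1
    have h5 : 0 ≤ jb x ^ (-2 + 2 * α) := Real.rpow_nonneg (by linarith [one_le_jb x]) _
    have h6 : 0 ≤ (jb (x + n))⁻¹ := inv_nonneg.2 (by linarith [one_le_jb (x + n)])
    calc (jb (x + n))⁻¹ * jb x ^ (-2 + 2 * α)
        ≤ (2 * ∑ j ∈ Finset.range (k + 4),
            ((2 : ℝ) ^ j)⁻¹ * (if jb (x + n) ≤ 2 ^ j then 1 else 0)) * (4 * W) :=
          mul_le_mul h3 h4 h5 (h6.trans h3)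
      _ = _ := by ring
  have hpiece : ∀ j ∈ Finset.range (k + 4),
      ((2 : ℝ) ^ j)⁻¹ * ∑ m ∈ M, (√(1 + (m : ℝ) ^ 2))⁻¹ *
        (((F m).filter (fun x => jb (x + n) ≤ 2 ^ j)).card : ℝ) ≤
      48000 * (5 * Real.log (2 + N)) * (√(2 ^ j) + 2 ^ j * (1 / √(jb n))) := by
    intro j hj
    have h2j : (1 : ℝ) ≤ 2 ^ j := one_le_pow₀ one_le_two
    have h2j' : (2 : ℝ) ^ j ≤ 8 * N := by
      rw [← h8]
      exact pow_le_pow_right₀ one_le_two (by rw [Finset.mem_range] at hj; omega)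
    have h1 := sum_card_phase_level_translate_le h2j K hσ hτ (n := n) M
      (A.filter (fun x => jb (x + n) ≤ 2 ^ j))
      (fun x hx => (norm_le_jb _).trans (Finset.mem_filter.1 hx).2)
    have h2 : Real.log (2 + 6 * 2 ^ j) ≤ 5 * Real.log (2 + N) :=
      (Real.log_le_log (by positivity) (by linarith)).trans hl
    have h3 : ((2 : ℝ) ^ j)⁻¹ * ((2 ^ j) ^ 2 * (1 / √(2 ^ j) + 1 / √(jb n)))
        = √(2 ^ j) + 2 ^ j * (1 / √(jb n)) := by
      have : √((2 : ℝ) ^ j) = 2 ^ j * (1 / √(2 ^ j)) := by rw [mul_one_div, Real.div_sqrt]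
      have e : ((2 : ℝ) ^ j)⁻¹ * (2 ^ j) ^ 2 = 2 ^ j := by field_simp
      rw [← mul_assoc, e, mul_add, ← this]
    have hcomm : ∀ m, (F m).filter (fun x => jb (x + n) ≤ 2 ^ j) =
        (A.filter (fun x => jb (x + n) ≤ 2 ^ j)).filter
          (fun x => |σ * jb (x + n) + τ * jb x + K - m| ≤ 1) := fun m => Finset.filter_comm _ _ _
    simp only [hcomm]
    calc _ ≤ ((2 : ℝ) ^ j)⁻¹ * (48000 * Real.log (2 + 6 * 2 ^ j) *
          ((2 ^ j) ^ 2 * (1 / √(2 ^ j) + 1 / √(jb n)))) :=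
          mul_le_mul_of_nonneg_left h1 (by positivity)
      _ = 48000 * Real.log (2 + 6 * 2 ^ j) * (√(2 ^ j) + 2 ^ j * (1 / √(jb n))) := by
          rw [← h3]; ring
      _ ≤ _ := by gcongr
  have hsq : √N ≤ 3 * (N * (1 / √(jb n))) := by
    have h1 : √(jb n) ≤ 3 * √N := by
      rw [show (3 : ℝ) = √9 by rw [show (9 : ℝ) = 3 ^ 2 by norm_num]; simp,
        ← Real.sqrt_mul (by norm_num)]
      exact Real.sqrt_le_sqrt (by linarith)
    have h2 : 0 < √(jb n) := Real.sqrt_pos.2 (by linarith)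
    rw [mul_one_div, ← mul_div_assoc, le_div_iff₀ h2]
    nlinarith [Real.sqrt_nonneg N, Real.mul_self_sqrt (by linarith : 0 ≤ N)]
  have hgeom : ∑ j ∈ Finset.range (k + 4), (√(2 ^ j) + 2 ^ j * (1 / √(jb n))) ≤
      52 * (N * (1 / √(jb n))) := by
    rw [Finset.sum_add_distrib, ← Finset.sum_mul]
    have h1 := sum_sqrt_two_pow_le (k + 4)
    have h2 := sum_two_pow_le (k + 4)
    have e : (2 : ℝ) ^ (k + 4) = 4 ^ 2 * N := by rw [pow_add, hNdef]; ring
    rw [e] at h1 h2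
    rw [Real.sqrt_mul (by norm_num), Real.sqrt_sq (by norm_num)] at h1
    have h3 : 0 ≤ 1 / √(jb n) := by positivity
    have h4 := mul_le_mul_of_nonneg_right h2 h3
    linarith
  calc _ ≤ ∑ m ∈ M, (√(1 + (m : ℝ) ^ 2))⁻¹ * ∑ x ∈ F m, 8 * W *
        ∑ j ∈ Finset.range (k + 4), ((2 : ℝ) ^ j)⁻¹ * (if jb (x + n) ≤ 2 ^ j then 1 else 0) := by
        refine Finset.sum_le_sum fun m _ => ?_
        refine mul_le_mul_of_nonneg_left ?_ (by positivity)
        exact Finset.sum_le_sum fun x hx => hw x (Finset.mem_filter.1 hx).1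
    _ = 8 * W * ∑ j ∈ Finset.range (k + 4), ((2 : ℝ) ^ j)⁻¹ * ∑ m ∈ M, (√(1 + (m : ℝ) ^ 2))⁻¹ *
        (((F m).filter (fun x => jb (x + n) ≤ 2 ^ j)).card : ℝ) := by
        have e : ∀ m, ∑ x ∈ F m, 8 * W * ∑ j ∈ Finset.range (k + 4),
            ((2 : ℝ) ^ j)⁻¹ * (if jb (x + n) ≤ 2 ^ j then 1 else 0) =
            8 * W * ∑ j ∈ Finset.range (k + 4), ((2 : ℝ) ^ j)⁻¹ *
              (((F m).filter (fun x => jb (x + n) ≤ 2 ^ j)).card : ℝ) := by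
          intro m
          rw [← Finset.mul_sum, Finset.sum_comm]
          congr 1
          refine Finset.sum_congr rfl fun j _ => ?_
          rw [← Finset.mul_sum, Finset.sum_boole]
        simp only [e]
        simp only [Finset.mul_sum]
        rw [Finset.sum_comm]
        exact Finset.sum_congr rfl fun j _ => Finset.sum_congr rfl fun m _ => by ring
    _ ≤ 8 * W * (48000 * (5 * Real.log (2 + N)) * (52 * (N * (1 / √(jb n))))) := by
        refine mul_le_mul_of_nonneg_left ?_ (by positivity)
        refine (Finset.sum_le_sum hpiece).trans ?_
        rw [← Finset.mul_sum]
        exact mul_le_mul_of_nonneg_left hgeom (by positivity)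
    _ = 99840000 * Real.log (2 + N) * (W * (N * (1 / √(jb n)))) := by ring
    _ ≤ 99840000 * Real.log (2 + N) * (5 * jb n ^ (-(sTildeAlpha α))) := by
        have := rpow_mul_inv_sqrt_le_of_le hα0 hα1 hB hBN
        gcongr
    _ ≤ _ := by
        have : 0 ≤ Real.log (2 + N) * jb n ^ (-(sTildeAlpha α)) :=
          mul_nonneg hl0 (Real.rpow_nonneg (by linarith) _)
        linarith

theorem finite_ann (N : ℝ) : {x : Fin 2 → ℤ | ann N x}.Finite := by
  refine (Fintype.piFinset fun _ : Fin 2 => Finset.Icc (-⌊2 * N⌋) ⌊2 * N⌋).finite_toSet.subset ?_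
  intro x hx
  rw [Finset.mem_coe, Fintype.mem_piFinset]
  intro i
  have h1 : |(x i : ℝ)| ≤ 2 * N :=
    (abs_apply_le_norm x i).trans ((znorm_eq_norm x).symm.le.trans hx.2)
  have h2 : |x i| ≤ ⌊2 * N⌋ := Int.le_floor.2 (by push_cast; exact h1)
  exact Finset.mem_Icc.2 (abs_le.1 h2)

/-- basic resonance estimate: for `0 < α < 1/2` there is `C > 0` depending
only on `α` such that for all signs, fixed `n₁, n₂ ∈ ℤ²` and every dyadic `N₃`,
`∑_{m} ⟨m⟩⁻¹ ∑_{|n₃|∼N₃} ⟨n₁+n₂+n₃⟩⁻¹ ⟨n₃⟩^{−2+2α} 1_{|φ−m|≤1}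
  ≤ C log(2+N₃) ⟨n₁+n₂⟩^{−s̃_α}`. -/
theorem basic_resonance_estimate (α : ℝ) (hα0 : 0 < α) (hα1 : α < 1 / 2) :
    ∃ C : ℝ, 0 < C ∧
      ∀ (σ σ₁ σ₂ σ₃ : ℝ), (σ = -1 ∨ σ = 1) → (σ₁ = -1 ∨ σ₁ = 1) →
        (σ₂ = -1 ∨ σ₂ = 1) → (σ₃ = -1 ∨ σ₃ = 1) →
        ∀ (n₁ n₂ : Fin 2 → ℤ) (k₃ : ℕ),
          (∑' m : ℤ, (Real.sqrt (1 + (m : ℝ) ^ 2))⁻¹ *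
            ∑' n₃ : Fin 2 → ℤ,
              Set.indicator
                {n₃ : Fin 2 → ℤ | ann ((2:ℝ)^k₃) n₃ ∧
                  |phase σ σ₁ σ₂ σ₃ n₁ n₂ n₃ - (m : ℝ)| ≤ 1}
                (fun n₃ => (jb (n₁ + n₂ + n₃))⁻¹ * jb n₃ ^ (-2 + 2 * α)) n₃) ≤
            C * Real.log (2 + (2:ℝ)^k₃) * jb (n₁ + n₂) ^ (-(sTildeAlpha α)) := by
  classical
  refine ⟨10 ^ 9, by norm_num, ?_⟩
  intro σ σ₁ σ₂ σ₃ hσ _ _ hσ₃ n₁ n₂ k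
  set A := (finite_ann ((2 : ℝ) ^ k)).toFinset with hAdef
  have hA : ∀ x ∈ A, (2 : ℝ) ^ k / 2 ≤ ‖toComplex x‖ ∧ ‖toComplex x‖ ≤ 2 * 2 ^ k := by
    intro x hx
    rw [← znorm_eq_norm]
    exact (finite_ann _).mem_toFinset.1 hx
  set K := σ₁ * jb n₁ + σ₂ * jb n₂ with hK
  have hphase : ∀ x, phase σ σ₁ σ₂ σ₃ n₁ n₂ x = σ * jb (x + (n₁ + n₂)) + σ₃ * jb x + K := by
    intro x
    rw [phase, hK, add_comm x]; ring
  refine Real.tsum_le_of_sum_le ?_ ?_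
  · intro m
    refine mul_nonneg (by positivity) (tsum_nonneg fun x => Set.indicator_nonneg ?_ x)
    intro x _
    have h1 := one_le_jb (n₁ + n₂ + x)
    have h2 := one_le_jb x
    positivity
  · intro M
    have e : ∀ m : ℤ, ∑' n₃ : Fin 2 → ℤ, Set.indicator
        {n₃ : Fin 2 → ℤ | ann ((2 : ℝ) ^ k) n₃ ∧
          |phase σ σ₁ σ₂ σ₃ n₁ n₂ n₃ - (m : ℝ)| ≤ 1}
        (fun n₃ => (jb (n₁ + n₂ + n₃))⁻¹ * jb n₃ ^ (-2 + 2 * α)) n₃ =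
        ∑ x ∈ A.filter (fun x => |σ * jb (x + (n₁ + n₂)) + σ₃ * jb x + K - m| ≤ 1),
          (jb (x + (n₁ + n₂)))⁻¹ * jb x ^ (-2 + 2 * α) := by
      intro m
      have hmem : ∀ x, x ∈ A.filter
          (fun x => |σ * jb (x + (n₁ + n₂)) + σ₃ * jb x + K - m| ≤ 1) ↔
          x ∈ {n₃ : Fin 2 → ℤ | ann ((2 : ℝ) ^ k) n₃ ∧
            |phase σ σ₁ σ₂ σ₃ n₁ n₂ n₃ - (m : ℝ)| ≤ 1} := by
        intro x
        rw [Finset.mem_filter, hAdef, (finite_ann _).mem_toFinset, ← hphase]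
        rfl
      rw [tsum_eq_sum (s := A.filter
        (fun x => |σ * jb (x + (n₁ + n₂)) + σ₃ * jb x + K - m| ≤ 1))]
      · refine Finset.sum_congr rfl fun x hx => ?_
        rw [Set.indicator_of_mem ((hmem x).1 hx), add_comm x]
      · intro x hx
        exact Set.indicator_of_notMem (fun h => hx ((hmem x).2 h)) _
    simp only [e]
    rcases le_total (4 * (2 : ℝ) ^ k) ‖toComplex (n₁ + n₂)‖ with h | h
    · exact sum_resonance_le_of_le hα0 hα1 K hσ hσ₃ (one_le_pow₀ one_le_two) h M A hA
    · exact sum_resonance_le_of_ge hα0 hα1 K hσ hσ₃ k h M A hA
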